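/- Assume e ∈ dcl(Σ) and fix a Lascar tuple b with e ∈ dcl(b). Let H = π_b^{-1}[Gal^0_L(Σ, e)] ≤ Aut_e(Σ), where Gal^0_L(Σ, e) is the connected component of the identity of Gal_L(Σ, e). Then for tuples c and d of realizations of Σ, c ≡^H d if and only if c ≡^S_e d. -/

import Mathlib

/- Framework: relativized Lascar groups of a first-order theory over a
hyperimaginary, following "Relativized Galois groups of first order theories
over a hyperimaginary" by H. Lee and J. Lee. -/

open FirstOrder Cardinal Pointwise

universe u

namespace RelLascar

variable {L : FirstOrder.Language.{u, u}} {M : Type u} [L.Structure M]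

/-- The group of automorphisms of the monster model `M`. -/
instance : Group (M ≃[L] M) where
  mul f g := f.comp g
  one := FirstOrder.Language.Equiv.refl L M
  inv f := f.symm
  mul_assoc f g h := (FirstOrder.Language.Equiv.comp_assoc h g f).symm
  one_mul := FirstOrder.Language.Equiv.refl_comp
  mul_one := FirstOrder.Language.Equiv.comp_refl
  inv_mul_cancel := FirstOrder.Language.Equiv.symm_comp_self

/-- Automorphisms act on the monster model. -/
instance : MulAction (M ≃[L] M) M where
  smul f x := f x
  one_smul _ := rfl
  mul_smul _ _ _ := rfl

@[simp] theorem autSmul_def (f : M ≃[L] M) (x : M) : f • x = f x := rfl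

/-- The solution set in `M` of a set of formulas in variables `ι` with
parameters `prm : π → M`. -/
def SolSet {ι π : Type u} (p : Set (L.Formula (ι ⊕ π))) (prm : π → M) : Set (ι → M) :=
  {v | ∀ φ ∈ p, φ.Realize (Sum.elim v prm)}

/-- A set of `ι`-tuples is type-definable over the parameters `prm`. -/
def TypeDefinableOver {ι π : Type u} (prm : π → M) (X : Set (ι → M)) : Prop :=
  ∃ p : Set (L.Formula (ι ⊕ π)), X = SolSet p prm

/-- Two tuples have the same (complete) type over `∅`. -/
def SameTp {ι : Type u} (c d : ι → M) : Prop :=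
  ∀ φ : L.Formula ι, φ.Realize c ↔ φ.Realize d

/-- `M` is a monster model with degree of saturation and strong homogeneity `κ`:
`κ` is uncountable, tuples of size `< κ` with the same type are conjugate under an
automorphism, and every partial type in `< κ` variables over `< κ` parameters that
is finitely realized in `M` is realized in `M`.  ("Small" means of size `< κ`.) -/
def IsMonster (κ : Cardinal.{u}) (L : FirstOrder.Language.{u, u}) (M : Type u) [L.Structure M] : Prop :=
  ℵ₀ < κ ∧
  (∀ (ι : Type u) (c d : ι → M), #ι < κ → SameTp (L := L) (M := M) c d →
      ∃ f : M ≃[L] M, ∀ i, f (c i) = d i) ∧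
  (∀ (ι π : Type u) (prm : π → M) (p : Set (L.Formula (ι ⊕ π))), #ι < κ → #π < κ →
      (∀ q : Finset (L.Formula (ι ⊕ π)), ↑q ⊆ p →
        ∃ v : ι → M, ∀ φ ∈ (q : Set (L.Formula (ι ⊕ π))), φ.Realize (Sum.elim v prm)) →
      ∃ v : ι → M, v ∈ SolSet p prm)

variable (κ : Cardinal.{u})

section Hyperimaginary

/- The hyperimaginary `e = a_E`, where `E` is the `∅`-type-definable equivalence
relation defined by the set of formulas `pE` and `a : γ → M`. -/
variable {γ : Type u} (pE : Set (L.Formula (γ ⊕ γ))) (a : γ → M)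

/-- The relation defined by a set of formulas in variables `δ ⊕ δ` (with no
parameters); for `pE` this is the equivalence relation `E`. -/
def Frel {δ : Type u} (pF : Set (L.Formula (δ ⊕ δ))) (x y : δ → M) : Prop :=
  ∀ φ ∈ pF, φ.Realize (Sum.elim x y)

/-- The class of a tuple `x` under the relation defined by `pF`; for an
equivalence relation this is the hyperimaginary `x_F` (as a set of representatives). -/
def Fclass {δ : Type u} (pF : Set (L.Formula (δ ⊕ δ))) (x : δ → M) : Set (δ → M) :=
  {y | Frel pF x y}

/-- `Aut_e(𝔠)`: the subgroup of automorphisms fixing the hyperimaginary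
`e = a_E` setwise. -/
def AutE : Subgroup (M ≃[L] M) := MulAction.stabilizer (M ≃[L] M) (Fclass pE a)

/-- `Aut_e(𝔠)` as a group. -/
abbrev Ge := ↥(AutE pE a)

/-- The hyperimaginary `e` is definable over the tuple `t` (i.e. `e ∈ dcl(t)`):
every automorphism fixing `t` pointwise fixes `e`. -/
def eInDclTuple {ι : Type u} (t : ι → M) : Prop :=
  ∀ f : M ≃[L] M, (∀ i, f (t i) = t i) → f ∈ AutE pE a

/-- The set of elements of `Aut_e(𝔠)` fixing pointwise some small elementary
substructure (model) `N` with `e ∈ dcl(N)`. -/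
def modelFixers : Set (Ge pE a) :=
  {f | ∃ N : L.ElementarySubstructure M, #N < κ ∧
        (∀ g : M ≃[L] M, (∀ x ∈ N, g x = x) → g ∈ AutE pE a) ∧
        ∀ x ∈ N, (f : M ≃[L] M) x = x}

/-- `Autf_L(𝔠, e)`: the normal subgroup of `Aut_e(𝔠)` generated by the
pointwise stabilizers of small models `N` with `e ∈ dcl(N)`. -/
def AutfL : Subgroup (Ge pE a) := Subgroup.normalClosure (modelFixers κ pE a)

/-- `c ≡ᴸ_e d` : the tuples have the same Lascar strong type over `e`. -/
def LEq {ι : Type u} (c d : ι → M) : Prop := ∃ f ∈ AutfL κ pE a, f • c = d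

theorem LEq.refl {ι : Type u} (c : ι → M) : LEq κ pE a c c :=
  ⟨1, one_mem _, one_smul _ _⟩

theorem LEq.symm {ι : Type u} {c d : ι → M} (h : LEq κ pE a c d) : LEq κ pE a d c := by
  obtain ⟨f, hf, rfl⟩ := h
  exact ⟨f⁻¹, inv_mem hf, inv_smul_smul f c⟩

theorem LEq.trans {ι : Type u} {c d e : ι → M} (h1 : LEq κ pE a c d)
    (h2 : LEq κ pE a d e) : LEq κ pE a c e := by
  obtain ⟨f, hf, rfl⟩ := h1
  obtain ⟨g, hg, rfl⟩ := h2
  exact ⟨g * f, mul_mem hg hf, (mul_smul g f c).symm ▸ rfl⟩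

end Hyperimaginary

section Sigma

variable {γ : Type u} (pE : Set (L.Formula (γ ⊕ γ))) (a : γ → M)
variable {V β : Type u} {pS : Set (L.Formula (V ⊕ β))} {bp : β → M}

/-- The solution set `Σ(𝔠)` of the partial type `Σ` (given by formulas `pS` over
the parameters `bp`). -/
abbrev Sol (pS : Set (L.Formula (V ⊕ β))) (bp : β → M) : Set (V → M) := SolSet pS bp

/-- The type of realizations of `Σ`. -/
abbrev SolT (pS : Set (L.Formula (V ⊕ β))) (bp : β → M) := ↥(Sol pS bp)

variable (pS bp) in
/-- The partial type `Σ` is `e`-invariant. -/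
def SolInv : Prop := ∀ (g : Ge pE a) (v : V → M), v ∈ Sol pS bp → g • v ∈ Sol pS bp

/-- The restriction homomorphism `Aut_e(𝔠) → Perm(Σ(𝔠))`, `f ↦ f ↾ Σ(𝔠)`. -/
def resPerm (hInv : SolInv pE a pS bp) : Ge pE a →* Equiv.Perm (SolT pS bp) where
  toFun g :=
    { toFun := fun v => ⟨g • (v : V → M), hInv g v v.2⟩
      invFun := fun v => ⟨g⁻¹ • (v : V → M), hInv g⁻¹ v v.2⟩
      left_inv := fun v => Subtype.ext (inv_smul_smul g (v : V → M))
      right_inv := fun v => Subtype.ext (smul_inv_smul g (v : V → M)) }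
  map_one' := Equiv.ext fun v => Subtype.ext (one_smul (Ge pE a) (v : V → M))
  map_mul' g h := Equiv.ext fun v => Subtype.ext (mul_smul g h (v : V → M))

/-- `Aut_e(Σ) = {f ↾ Σ(𝔠) : f ∈ Aut_e(𝔠)}`, as a subgroup of the permutations of
`Σ(𝔠)`. -/
def AutES (hInv : SolInv pE a pS bp) : Subgroup (Equiv.Perm (SolT pS bp)) :=
  (resPerm pE a hInv).range

/-- `Aut_e(Σ)` as a group. -/
abbrev GS (hInv : SolInv pE a pS bp) := ↥(AutES pE a hInv)

/-- The restriction map `ξ : Aut_e(𝔠) → Aut_e(Σ)`. -/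
def toGS (hInv : SolInv pE a pS bp) : Ge pE a →* GS pE a hInv :=
  (resPerm pE a hInv).rangeRestrict

/-- A tuple of realizations of `Σ`, flattened to a tuple of elements of `M`. -/
def flat {ι : Type u} (c : ι → SolT pS bp) : ι × V → M := fun p => (c p.1 : V → M) p.2

theorem flat_toGS_smul (hInv : SolInv pE a pS bp) {ι : Type u} (g : Ge pE a)
    (c : ι → SolT pS bp) : flat ((toGS pE a hInv g) • c) = g • flat c := rfl

theorem flat_smul_of_res (hInv : SolInv pE a pS bp) {ι : Type u} {τ : GS pE a hInv}
    {g : Ge pE a} (hg : resPerm pE a hInv g = ↑τ) (c : ι → SolT pS bp) :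
    flat (τ • c) = g • flat c := by
  have : τ = toGS pE a hInv g := Subtype.ext hg.symm
  subst this
  rfl

/-- `Autf_L(Σ, e)`: the subgroup of `Aut_e(Σ)` consisting of those restricted
automorphisms `σ` such that every small tuple of realizations of `Σ` has the same
Lascar strong type over `e` as its image under `σ`. -/
def AutfLS (hInv : SolInv pE a pS bp) : Subgroup (GS pE a hInv) where
  carrier := {σ | ∀ (ι : Type u), #ι < κ → ∀ c : ι → SolT pS bp,
      LEq κ pE a (flat c) (flat (σ • c))}
  one_mem' := by
    intro ι _ c
    rw [one_smul]
    exact LEq.refl κ pE a _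
  mul_mem' := by
    intro σ τ hσ hτ ι hι c
    rw [mul_smul]
    exact LEq.trans κ pE a (hτ ι hι c) (hσ ι hι (τ • c))
  inv_mem' := by
    intro σ hσ ι hι c
    have h := hσ ι hι (σ⁻¹ • c)
    rw [smul_inv_smul] at h
    exact LEq.symm κ pE a h

theorem AutfLS_normal (hInv : SolInv pE a pS bp) : (AutfLS κ pE a hInv).Normal := by
  constructor
  intro σ hσ τ ι hι c
  obtain ⟨g, hg⟩ := τ.2
  have hginv : resPerm pE a hInv g⁻¹ = ↑τ⁻¹ := by
    rw [map_inv, hg]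
    rfl
  obtain ⟨f, hf, hfe⟩ := hσ ι hι (τ⁻¹ • c)
  refine ⟨g * f * g⁻¹, (Subgroup.normalClosure_normal).conj_mem f hf g, ?_⟩
  have h1 : flat (τ⁻¹ • c) = g⁻¹ • flat c := flat_smul_of_res pE a hInv hginv c
  have h2 : flat ((τ * σ * τ⁻¹) • c) = g • flat (σ • τ⁻¹ • c) := by
    rw [mul_smul, mul_smul]
    exact flat_smul_of_res pE a hInv hg _
  rw [h2, ← hfe, h1, ← mul_smul, ← mul_smul]

/-- The relativized Lascar group `Gal_L(Σ, e) = Aut_e(Σ) / Autf_L(Σ, e)`. -/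
def GalL (hInv : SolInv pE a pS bp) := GS pE a hInv ⧸ AutfLS κ pE a hInv

/-- The projection `π_b : Aut_e(Σ) → Gal_L(Σ, e)`. -/
def projb (hInv : SolInv pE a pS bp) : GS pE a hInv → GalL κ pE a hInv :=
  QuotientGroup.mk

/-- The projection `π_Σ : Aut_e(𝔠) → Gal_L(Σ, e)`. -/
def projS (hInv : SolInv pE a pS bp) : Ge pE a → GalL κ pE a hInv :=
  fun g => projb κ pE a hInv (toGS pE a hInv g)

/-- A Lascar tuple in `Σ` over `e`: a small tuple `b` of realizations of `Σ` such
that `Autf_L(Σ, e) = {σ ∈ Aut_e(Σ) : b ≡ᴸ_e σ(b)}`. -/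
def IsLascarTuple (hInv : SolInv pE a pS bp) {ιb : Type u} (b : ιb → SolT pS bp) : Prop :=
  #ιb < κ ∧ ∀ σ : GS pE a hInv,
    σ ∈ AutfLS κ pE a hInv ↔ LEq κ pE a (flat b) (flat (σ • b))

variable (pS bp) in
/-- `e ∈ dcl(Σ)`: there is a small tuple of realizations of `Σ` over which `e` is
definable. -/
def eInDclSigma : Prop :=
  ∃ (ι : Type u) (c : ι → SolT pS bp), #ι < κ ∧ eInDclTuple pE a (flat c)

/-- The complete type of the tuple `v` over the parameters `prm` (with both
indexed by `ι`): the set of formulas realized by `v` with parameters `prm`. -/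
def tpOver {ι : Type u} (prm v : ι → M) : Set (L.Formula (ι ⊕ ι)) :=
  {φ | φ.Realize (Sum.elim v prm)}

/-- The type space `S_b(b) = {tp(f(b)/b) : f ∈ Aut_e(𝔠)}` over a tuple `b` of
realizations of `Σ`. -/
def Sb {ιb : Type u} (b : ιb → SolT pS bp) :
    Set (Set (L.Formula ((ιb × V) ⊕ (ιb × V)))) :=
  Set.range fun g : Ge pE a => tpOver (flat b) (g • flat b)

/-- The logic topology on a set of types: the subspace topology induced from the
product topology on `Formula → Bool` via characteristic functions. -/
noncomputable def typeSetTop {F : Type u} (X : Set (Set F)) : TopologicalSpace ↥X :=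
  TopologicalSpace.induced
    (fun p (φ : F) => (p : Set F).boolIndicator φ) inferInstance

/-- The map `ν_b : S_b(b) → Gal_L(Σ, e)`, `tp(σ(b)/b) ↦ [σ]`. -/
noncomputable def nub (hInv : SolInv pE a pS bp) {ιb : Type u} (b : ιb → SolT pS bp) :
    ↥(Sb pE a b) → GalL κ pE a hInv :=
  fun p => projS κ pE a hInv (Set.mem_range.mp p.2).choose

/-- The topology `𝔱_b` on the relativized Lascar group `Gal_L(Σ, e)`: the quotient
topology induced by `ν_b` from the logic topology on `S_b(b)`. -/
noncomputable def galTopb (hInv : SolInv pE a pS bp) {ιb : Type u}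
    (b : ιb → SolT pS bp) : TopologicalSpace (GalL κ pE a hInv) :=
  (typeSetTop (Sb pE a b)).coinduced (nub κ pE a hInv b)

end Sigma

section GalT

variable {γ : Type u} (pE : Set (L.Formula (γ ⊕ γ))) (a : γ → M)

/-- The Lascar group `Gal_L(T, e) = Aut_e(𝔠) / Autf_L(𝔠, e)`. -/
def GalT := Ge pE a ⧸ AutfL κ pE a

/-- The projection `π : Aut_e(𝔠) → Gal_L(T, e)`. -/
def projT : Ge pE a → GalT κ pE a := QuotientGroup.mk

/-- The type space `S_N(N) = {tp(f(N)/N) : f ∈ Aut_e(𝔠)}` over a small model `N`. -/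
def SMod (N : L.ElementarySubstructure M) : Set (Set (L.Formula (↥N ⊕ ↥N))) :=
  Set.range fun g : Ge pE a =>
    tpOver (Subtype.val : ↥N → M) (g • (Subtype.val : ↥N → M))

/-- The map `ν : S_N(N) → Gal_L(T, e)`, `tp(f(N)/N) ↦ [f]`. -/
noncomputable def nuT (N : L.ElementarySubstructure M) :
    ↥(SMod pE a N) → GalT κ pE a :=
  fun p => projT κ pE a (Set.mem_range.mp p.2).choose

/-- The standard quotient topology on the Lascar group `Gal_L(T, e)` induced via
the type space over a small model `N` (with `e ∈ dcl(N)`). -/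
noncomputable def galTopT (N : L.ElementarySubstructure M) :
    TopologicalSpace (GalT κ pE a) :=
  (typeSetTop (SMod pE a N)).coinduced (nuT κ pE a N)

/-- `Autf_KP(𝔠, e)`: the preimage under `π` of the closure of the identity in
`Gal_L(T, e)`. -/
noncomputable def AutfKPset (N : L.ElementarySubstructure M) : Set (Ge pE a) :=
  projT κ pE a ⁻¹' (@closure _ (galTopT κ pE a N) {projT κ pE a 1})

/-- `Autf_S(𝔠, e)`: the preimage under `π` of the connected component of the
identity in `Gal_L(T, e)`. -/
noncomputable def AutfSset (N : L.ElementarySubstructure M) : Set (Ge pE a) :=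
  projT κ pE a ⁻¹' (@connectedComponent _ (galTopT κ pE a N) (projT κ pE a 1))

/-- `c ≡ᴷᴾ_e d` : the tuples have the same KP strong type over `e`. -/
def KPeq (N : L.ElementarySubstructure M) {ι : Type u} (c d : ι → M) : Prop :=
  ∃ f ∈ AutfKPset κ pE a N, f • c = d

/-- `c ≡ˢ_e d` : the tuples have the same Shelah strong type over `e`. -/
def Seq (N : L.ElementarySubstructure M) {ι : Type u} (c d : ι → M) : Prop :=
  ∃ f ∈ AutfSset κ pE a N, f • c = d

end GalT

section Relativized

variable {γ : Type u} (pE : Set (L.Formula (γ ⊕ γ))) (a : γ → M)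
variable {V β : Type u} {pS : Set (L.Formula (V ⊕ β))} {bp : β → M}

/-- `Autf_KP(Σ, e)`: the set of restricted automorphisms fixing the KP strong
type of every small tuple of realizations of `Σ`. -/
noncomputable def AutfKPSset (hInv : SolInv pE a pS bp) (N : L.ElementarySubstructure M) :
    Set (GS pE a hInv) :=
  {σ | ∀ (ι : Type u), #ι < κ → ∀ c : ι → SolT pS bp,
      KPeq κ pE a N (flat c) (flat (σ • c))}

/-- `Autf_S(Σ, e)`: the set of restricted automorphisms fixing the Shelah strong
type of every small tuple of realizations of `Σ`. -/
noncomputable def AutfSSset (hInv : SolInv pE a pS bp) (N : L.ElementarySubstructure M) :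
    Set (GS pE a hInv) :=
  {σ | ∀ (ι : Type u), #ι < κ → ∀ c : ι → SolT pS bp,
      Seq κ pE a N (flat c) (flat (σ • c))}

/-- The orbit under `Aut_e(𝔠)` of the hyperimaginary given by the class of `x`
under the relation defined by `pF` is small ("`x_F` is bounded over `e`"). -/
def BoundedClass {δ : Type u} (pF : Set (L.Formula (δ ⊕ δ))) (x : δ → M) : Prop :=
  #↥(Set.range fun g : Ge pE a => g • Fclass pF x) < κ

/-- The orbit under `Aut_e(𝔠)` of the hyperimaginary given by the class of `x` is
finite ("`x_F` is algebraic over `e`"). -/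
def FiniteClass {δ : Type u} (pF : Set (L.Formula (δ ⊕ δ))) (x : δ → M) : Prop :=
  (Set.range fun g : Ge pE a => g • Fclass pF x).Finite

/-- `f` fixes the hyperimaginary given by the class of `x` (setwise). -/
def FixesClass (f : Ge pE a) {δ : Type u} (pF : Set (L.Formula (δ ⊕ δ)))
    (x : δ → M) : Prop :=
  f • Fclass pF x = Fclass pF x

variable (pS bp) in
/-- `f` fixes every hyperimaginary that is bounded over `e` and has a
representative which is a small tuple of realizations of `Σ`, i.e. `f` fixes
`bdd(e) ∩ Σ` pointwise. -/
def fixesAllBddS (f : Ge pE a) : Prop :=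
  ∀ (ι : Type u) (pF : Set (L.Formula ((ι × V) ⊕ (ι × V)))) (c : ι → SolT pS bp),
    #ι < κ → Equivalence (Frel (M := M) pF) → BoundedClass κ pE a pF (flat c) →
    FixesClass pE a f pF (flat c)

variable (pS bp) in
/-- `f` fixes every hyperimaginary that is algebraic over `e` and has a
representative which is a small tuple of realizations of `Σ`, i.e. `f` fixes
`acl(e) ∩ Σ` pointwise. -/
def fixesAllAclS (f : Ge pE a) : Prop :=
  ∀ (ι : Type u) (pF : Set (L.Formula ((ι × V) ⊕ (ι × V)))) (c : ι → SolT pS bp),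
    #ι < κ → Equivalence (Frel (M := M) pF) → FiniteClass pE a pF (flat c) →
    FixesClass pE a f pF (flat c)

end Relativized


section More

variable {γ : Type u} (pE : Set (L.Formula (γ ⊕ γ))) (a : γ → M)
variable {V β : Type u} {pS : Set (L.Formula (V ⊕ β))} {bp : β → M}

theorem mem_AutfLS_iff (hInv : SolInv pE a pS bp) {σ : GS pE a hInv} :
    σ ∈ AutfLS κ pE a hInv ↔ ∀ (ι : Type u), #ι < κ → ∀ c : ι → SolT pS bp,
      LEq κ pE a (flat c) (flat (σ • c)) := Iff.rfl

theorem toGS_mem_autfLS (hInv : SolInv pE a pS bp) {f : Ge pE a}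
    (hf : f ∈ AutfL κ pE a) : toGS pE a hInv f ∈ AutfLS κ pE a hInv :=
  (mem_AutfLS_iff κ pE a hInv).mpr
    (fun ι _ c => ⟨f, hf, (flat_toGS_smul pE a hInv f c).symm⟩)

instance AutfL_normal : (AutfL κ pE a).Normal :=
  Subgroup.normalClosure_normal

/-- The group structure of the relativized Lascar group `Gal_L(Σ, e)`. -/
noncomputable def galLGroup (hInv : SolInv pE a pS bp) : Group (GalL κ pE a hInv) :=
  @QuotientGroup.Quotient.group _ _ (AutfLS κ pE a hInv) (AutfLS_normal κ pE a hInv)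

/-- The natural projection `ξ_L : Gal_L(T, e) → Gal_L(Σ, e)`. -/
noncomputable def xiL (hInv : SolInv pE a pS bp) : GalT κ pE a → GalL κ pE a hInv :=
  haveI := AutfLS_normal κ pE a hInv
  ⇑(QuotientGroup.map (AutfL κ pE a) (AutfLS κ pE a hInv) (toGS pE a hInv)
    (fun _ hf => Subgroup.mem_comap.mpr (toGS_mem_autfLS κ pE a hInv hf)))

/-- The orbit equivalence relation `≡ᴴ` of a set `H` of restricted automorphisms,
on tuples of realizations of `Σ`. -/
def orbEq {hInv : SolInv pE a pS bp} (H : Set (GS pE a hInv)) {ι : Type u}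
    (c d : ι → SolT pS bp) : Prop :=
  ∃ h ∈ H, h • c = d

end More

section Topological

open Set
open scoped Topology

/-- In a compact normal space, every point lying in all clopen neighbourhoods of `x` belongs to
the connected component of `x`. -/
theorem mem_connectedComponent_of_forall_isClopen {X : Type*} [TopologicalSpace X]
    [CompactSpace X] [NormalSpace X] {x y : X} (h : ∀ s : Set X, IsClopen s → x ∈ s → y ∈ s) :
    y ∈ connectedComponent x := by
  have hs : IsClosed (⋂ s : { s : Set X // IsClopen s ∧ x ∈ s }, (s : Set X)) :=
    isClosed_iInter fun s => s.2.1.1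
  suffices hc : IsPreconnected (⋂ s : { s : Set X // IsClopen s ∧ x ∈ s }, (s : Set X)) from
    hc.subset_connectedComponent (mem_iInter.2 fun s => s.2.2)
      (mem_iInter.2 fun s => h s s.2.1 s.2.2)
  rw [isPreconnected_iff_subset_of_fully_disjoint_closed hs]
  intro a b ha hb hab ab_disj
  obtain ⟨u, v, hu, hv, hau, hbv, huv⟩ := normal_separation ha hb ab_disj
  obtain ⟨s, hsc, hxs, hsuv⟩ : ∃ s : Set X, IsClopen s ∧ x ∈ s ∧ s ⊆ u ∪ v := by
    have H1 := (hu.union hv).isClosed_compl.isCompact.inter_iInter_nonempty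
      (fun s : { s : Set X // IsClopen s ∧ x ∈ s } => (s : Set X)) fun s => s.2.1.1
    rw [← not_disjoint_iff_nonempty_inter, imp_not_comm, not_forall] at H1
    obtain ⟨si, H2⟩ :=
      H1 (disjoint_compl_left_iff_subset.2 <| hab.trans <| union_subset_union hau hbv)
    refine ⟨⋂ U ∈ si, Subtype.val U, ?_, ?_, ?_⟩
    · exact isClopen_biInter_finset fun s _ => s.2.1
    · exact mem_iInter₂.2 fun s _ => s.2.2
    · rwa [← disjoint_compl_left_iff_subset, disjoint_iff_inter_eq_empty,
        ← not_nonempty_iff_eq_empty]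
  have hsub : ∀ w, IsClopen (s ∩ w) → x ∈ w →
      (⋂ s : { s : Set X // IsClopen s ∧ x ∈ s }, (s : Set X)) ⊆ w := fun w hw hxw =>
    (iInter_subset (fun s : { s : Set X // IsClopen s ∧ x ∈ s } => (s : Set X))
      ⟨s ∩ w, hw, hxs, hxw⟩).trans inter_subset_right
  rcases hsuv hxs with hxu | hxv
  · exact Or.inl (Disjoint.left_le_of_le_sup_right hab
      (huv.mono (hsub u (isClopen_inter_of_disjoint_cover_clopen hsc hsuv hu hv huv) hxu) hbv))
  · rw [union_comm] at hsuv
    exact Or.inr (Disjoint.left_le_of_le_sup_left hab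
      (huv.symm.mono (hsub v (isClopen_inter_of_disjoint_cover_clopen hsc hsuv hv hu huv.symm) hxv)
        hau))

/-- If products of closed sets are closed, then every clopen neighbourhood of `1` contains an
open subgroup. -/
theorem exists_openSubgroup_subset_of_isClopen
    {G : Type*} [Group G] [TopologicalSpace G] [ContinuousInv G]
    (hmul : ∀ C D : Set G, IsClosed C → IsClosed D → IsClosed (C * D))
    {W : Set G} (hW : IsClopen W) (h1 : 1 ∈ W) :
    ∃ U : Subgroup G, IsOpen (U : Set G) ∧ (U : Set G) ⊆ W := by
  refine ⟨MulAction.stabilizer G W, ?_, fun u hu => ?_⟩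
  · have : ((MulAction.stabilizer G W : Subgroup G) : Set G)ᶜ = Wᶜ * W⁻¹ ∪ W * Wᶜ⁻¹ := by
      ext u
      simp only [mem_compl_iff, SetLike.mem_coe, MulAction.mem_stabilizer_set, mem_union, mem_mul,
        Set.mem_inv]
      constructor
      · intro h
        push Not at h
        obtain ⟨w, ⟨h1, h2⟩ | ⟨h1, h2⟩⟩ := h
        · exact Or.inr ⟨u * w, h1, w⁻¹, by simpa using h2, by simp⟩
        · exact Or.inl ⟨u * w, h1, w⁻¹, by simpa using h2, by simp⟩
      · rintro (⟨x, hx, y, hy, rfl⟩ | ⟨x, hx, y, hy, rfl⟩) h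
        · exact hx (by simpa using (h y⁻¹).2 hy)
        · exact hy ((h y⁻¹).1 (by simpa using hx))
    rw [← isClosed_compl_iff, this]
    exact (hmul _ _ hW.compl.isClosed hW.isClosed.inv).union
      (hmul _ _ hW.isClosed hW.compl.isClosed.inv)
  · have := (MulAction.mem_stabilizer_set.1 hu 1).2 h1
    simpa using this

theorem isClopen_subgroup_mul {G : Type*} [Group G] [TopologicalSpace G]
    [SeparatelyContinuousMul G] {U : Subgroup G} (hU : IsOpen (U : Set G)) (Y : Set G) :
    IsClopen ((U : Set G) * Y) := by
  have key : ∀ Y : Set G, IsOpen ((U : Set G) * Y) := fun Y => by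
    rw [← iUnion_mul_right_image]
    exact isOpen_biUnion fun y _ => (Homeomorph.mulRight y).isOpenMap _ hU
  refine ⟨⟨?_⟩, key Y⟩
  convert key ((U : Set G) * Y)ᶜ using 1
  ext x
  simp only [mem_compl_iff, mem_mul, not_exists, not_and]
  constructor
  · exact fun h => ⟨1, one_mem U, x, h, one_mul x⟩
  · rintro ⟨u, hu, z, hz, rfl⟩ v hv y hy h
    refine hz (u⁻¹ * v) (mul_mem (inv_mem hu) hv) y hy ?_
    rw [mul_assoc, h, inv_mul_cancel_left]

/-- A set meeting every open subgroup meets the connected component of `1`, provided its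
saturation by the closure of `1` is closed. -/
theorem exists_mem_connectedComponent_one {G : Type*} [Group G] [TopologicalSpace G]
    [SeparatelyContinuousMul G] [ContinuousInv G] [CompactSpace G] [NormalSpace G]
    (hmul : ∀ C D : Set G, IsClosed C → IsClosed D → IsClosed (C * D))
    {F : Set G} (hF : IsClosed (F * closure {1}))
    (h : ∀ U : Subgroup G, IsOpen (U : Set G) → (F ∩ U).Nonempty) :
    ∃ f ∈ F, f ∈ connectedComponent (1 : G) := by
  let I := {U : Subgroup G // IsOpen (U : Set G)}
  have hcl : ∀ U : I, IsClosed ((U : Subgroup G) : Set G) := fun U =>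
    Subgroup.isClosed_of_isOpen U.1 U.2
  have hcl1 : ∀ U : I, closure {(1 : G)} ⊆ (U : Subgroup G) := fun U =>
    closure_minimal (by simp [one_mem]) (hcl U)
  obtain ⟨y, hyF, hy⟩ : ((F * closure {1}) ∩ ⋂ U : I, ((U : Subgroup G) : Set G)).Nonempty := by
    refine hF.isCompact.inter_iInter_nonempty _ hcl fun s => ?_
    have hopen : IsOpen ((⨅ U ∈ s, (U : Subgroup G) : Subgroup G) : Set G) := by
      simp only [Subgroup.coe_iInf]
      exact isOpen_biInter_finset fun U _ => U.2
    obtain ⟨f, hf, hfU⟩ := h _ hopen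
    refine ⟨f, ⟨f, hf, 1, subset_closure rfl, mul_one f⟩, ?_⟩
    simpa using hfU
  obtain ⟨f, hf, z, hz, rfl⟩ := hyF
  refine ⟨f, hf, mem_connectedComponent_of_forall_isClopen fun W hW h1 => ?_⟩
  obtain ⟨U, hU, hUW⟩ := exists_openSubgroup_subset_of_isClopen hmul hW h1
  refine hUW ?_
  have h2 := mem_iInter.1 hy ⟨U, hU⟩
  exact (Subgroup.mul_mem_cancel_right U (hcl1 ⟨U, hU⟩ hz)).1 h2

theorem mul_closure_one_of_isClosed {G : Type*} [Group G] [TopologicalSpace G]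
    [SeparatelyContinuousMul G] {A : Set G} (hA : IsClosed A) : A * closure {1} = A := by
  refine Subset.antisymm ?_ fun x hx => ⟨x, hx, 1, subset_closure rfl, mul_one x⟩
  rintro _ ⟨x, hx, z, hz, rfl⟩
  exact closure_minimal (s := {1}) (by simpa using hx)
    (hA.preimage (continuous_const_mul x)) hz

/-- A topology on a group is normal if it is coarser than a normal topology `τ` such that the
saturations of `τ`-closed sets by the closure of `1` are closed. -/
theorem normalSpace_of_le {G : Type*} [Group G] (τ : TopologicalSpace G) (hτ : @NormalSpace G τ)
    [σ : TopologicalSpace G] [SeparatelyContinuousMul G] [ContinuousInv G] (hle : τ ≤ σ)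
    (hsat : ∀ C : Set G, IsClosed[τ] C → IsClosed (C * closure {1})) : NormalSpace G := by
  refine ⟨fun A B hA hB hAB => ?_⟩
  obtain ⟨u, v, hu, hv, hAu, hBv, huv⟩ :=
    @normal_separation G τ hτ A B (hA.mono hle) (hB.mono hle) hAB
  have key : ∀ {A u : Set G}, IsClosed A → A ⊆ u → A ⊆ (uᶜ * closure {1})ᶜ := by
    rintro A u hA hAu _ hx ⟨p, hp, z, hz, rfl⟩
    have hz' : z⁻¹ ∈ closure {(1 : G)} := by
      have : closure {(1 : G)} ⊆ (closure {1})⁻¹ :=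
        closure_minimal (by simpa using subset_closure (mem_singleton (1 : G))) isClosed_closure.inv
      exact this hz
    refine hp (hAu ?_)
    rw [← mul_closure_one_of_isClosed hA]
    exact ⟨p * z, hx, z⁻¹, hz', by simp⟩
  refine ⟨(uᶜ * closure {1})ᶜ, (vᶜ * closure {1})ᶜ, ?_, ?_, key hA hAu, key hB hBv, ?_⟩
  · exact (hsat _ (@IsOpen.isClosed_compl G τ _ hu)).isOpen_compl
  · exact (hsat _ (@IsOpen.isClosed_compl G τ _ hv)).isOpen_compl
  · rw [disjoint_left]
    intro x hxu hxv
    have h : ∀ {w : Set G}, x ∈ (wᶜ * closure {1})ᶜ → x ∈ w := fun hw => by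
      by_contra hx
      exact hw ⟨x, hx, 1, subset_closure rfl, mul_one x⟩
    exact disjoint_left.1 huv (h hxu) (h hxv)

end Topological

section TypeTopology

open Set
open scoped Topology

theorem boolIndicator_congr {F : Type*} {A B : Set F} {φ : F} (h : φ ∈ A ↔ φ ∈ B) :
    A.boolIndicator φ = B.boolIndicator φ := by
  simp [Set.boolIndicator, h]

variable (L) in
/-- The logic topology on `X` induced by `x ↦ tp(ev x / r)`. -/
noncomputable abbrev tpTop {X : Type*} {δ π : Type u} (ev : X → δ → M) (r : π → M) :
    TopologicalSpace X :=
  TopologicalSpace.induced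
    (fun x (φ : L.Formula (δ ⊕ π)) =>
      {ψ : L.Formula (δ ⊕ π) | ψ.Realize (Sum.elim (ev x) r)}.boolIndicator φ) inferInstance

variable {X Y : Type*} {δ π δ' π' : Type u} {ev : X → δ → M} {r : π → M} {ev' : Y → δ' → M}
  {r' : π' → M}

theorem isClopen_tpTop (φ : L.Formula (δ ⊕ π)) :
    @IsClopen X (tpTop L ev r) {x | φ.Realize (Sum.elim (ev x) r)} := by
  let _ := tpTop L ev r
  have hc : Continuous fun x =>
      {ψ : L.Formula (δ ⊕ π) | ψ.Realize (Sum.elim (ev x) r)}.boolIndicator φ :=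
    @Continuous.comp _ _ _ (tpTop L ev r) _ _ _ _ (continuous_apply φ) continuous_induced_dom
  convert (isClopen_discrete {true}).preimage hc using 1
  ext x
  simp [← Set.mem_iff_boolIndicator]

theorem continuous_tpTop {f : X → Y}
    (h : ∀ φ' : L.Formula (δ' ⊕ π'), ∃ φ : L.Formula (δ ⊕ π),
      ∀ x, φ'.Realize (Sum.elim (ev' (f x)) r') ↔ φ.Realize (Sum.elim (ev x) r)) :
    Continuous[tpTop L ev r, tpTop L ev' r'] f := by
  let _ := tpTop L ev r
  refine continuous_induced_rng.2 (continuous_pi fun φ' => ?_)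
  obtain ⟨φ, hφ⟩ := h φ'
  refine (continuous_boolIndicator_iff_isClopen {x | φ'.Realize (Sum.elim (ev' (f x)) r')}).2 ?_
  simp only [hφ]
  exact isClopen_tpTop φ

theorem continuous_tpTop_of_comp {f : X → Y} (e : δ' ⊕ π' → δ ⊕ π)
    (h : ∀ x, Sum.elim (ev' (f x)) r' = Sum.elim (ev x) r ∘ e) :
    Continuous[tpTop L ev r, tpTop L ev' r'] f :=
  continuous_tpTop fun φ' => ⟨φ'.relabel e, fun x => by
    rw [h, FirstOrder.Language.Formula.realize_relabel]⟩

theorem realize_iff_of_inseparable {x y : X} (h : @Inseparable X (tpTop L ev r) x y)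
    (φ : L.Formula (δ ⊕ π)) :
    φ.Realize (Sum.elim (ev x) r) ↔ φ.Realize (Sum.elim (ev y) r) :=
  @Inseparable.mem_open_iff X (tpTop L ev r) _ _ _ h
    (@IsClopen.isOpen X (tpTop L ev r) _ (isClopen_tpTop φ))

/-- If the range of `ev` is compact for partial types over `r`, then the logic topology is
compact. -/
theorem compactSpace_tpTop
    (h : ∀ p : Set (L.Formula (δ ⊕ π)), (∀ q : Finset (L.Formula (δ ⊕ π)), ↑q ⊆ p →
        ∃ x, ∀ φ ∈ q, φ.Realize (Sum.elim (ev x) r)) →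
      ∃ x, ∀ φ ∈ p, φ.Realize (Sum.elim (ev x) r)) :
    @CompactSpace X (tpTop L ev r) := by
  let _ := tpTop L ev r
  refine ⟨isCompact_iff_ultrafilter_le_nhds.2 fun F _ => ?_⟩
  obtain ⟨x, hx⟩ := h {φ | ∀ᶠ y in F, φ.Realize (Sum.elim (ev y) r)} fun q hq =>
    Filter.Eventually.exists (f := (F : Filter X)) ((Filter.eventually_all_finset q).2 hq)
  refine ⟨x, mem_univ x, ?_⟩
  rw [nhds_induced, ← Filter.tendsto_iff_comap, tendsto_pi_nhds]
  intro φ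
  rw [nhds_discrete, Filter.tendsto_pure]
  have hF : ∀ᶠ y in F, φ.Realize (Sum.elim (ev y) r) ↔ φ.Realize (Sum.elim (ev x) r) := by
    by_cases hφ : φ.Realize (Sum.elim (ev x) r)
    · simp only [hφ, iff_true]
      by_contra hn
      rw [← Ultrafilter.eventually_not] at hn
      exact hx φ.not hn hφ
    · simp only [hφ, iff_false]
      rw [Ultrafilter.eventually_not]
      exact fun hn => hφ (hx φ hn)
  filter_upwards [hF] with y hy
  exact boolIndicator_congr hy

end TypeTopology

section AutTopology

open Set
open scoped Topology

variable {γ : Type u} {pE : Set (L.Formula (γ ⊕ γ))} {a : γ → M} {κ}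

theorem IsMonster.mk_sum_lt (hM : IsMonster κ L M) {α β : Type u} (hα : #α < κ) (hβ : #β < κ) :
    #(α ⊕ β) < κ := by
  rw [← Cardinal.add_def]
  exact Cardinal.add_lt_of_lt hM.1.le hα hβ

theorem IsMonster.mk_prod_lt (hM : IsMonster κ L M) {α β : Type u} (hα : #α < κ) (hβ : #β < κ) :
    #(α × β) < κ := by
  rw [← Cardinal.mul_def]
  exact Cardinal.mul_lt_of_lt hM.1.le hα hβ

theorem aut_realize_iff {α : Type*} (f : M ≃[L] M) (φ : L.Formula α) (v : α → M) :
    φ.Realize (f • v) ↔ φ.Realize v :=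
  FirstOrder.Language.StrongHomClass.realize_formula f φ

theorem Ge_realize_iff {α : Type*} (g : Ge pE a) (φ : L.Formula α) (v : α → M) :
    φ.Realize (g • v) ↔ φ.Realize v :=
  aut_realize_iff (g : M ≃[L] M) φ v

theorem smul_sumElim {S α β : Type*} [SMul S M] (f : S) (v : α → M) (w : β → M) :
    f • Sum.elim v w = Sum.elim (f • v) (f • w) := by
  ext (i | i) <;> rfl

theorem smul_Fclass (f : M ≃[L] M) : f • Fclass pE a = Fclass pE (f • a) := by
  ext y
  rw [Set.mem_smul_set_iff_inv_smul_mem]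
  simp only [Fclass, Frel, mem_ofPred_eq]
  refine forall₂_congr fun φ _ => ?_
  rw [← aut_realize_iff f, smul_sumElim, smul_inv_smul]

theorem mem_AutE_iff (hE : Equivalence (Frel (M := M) pE)) {f : M ≃[L] M} :
    f ∈ AutE pE a ↔ Frel pE a (f • a) := by
  rw [AutE, MulAction.mem_stabilizer_iff, smul_Fclass]
  constructor
  · intro h
    have : f • a ∈ Fclass pE (f • a) := hE.refl _
    rwa [h] at this
  · intro h
    ext y
    exact ⟨hE.trans h, hE.trans (hE.symm h)⟩

/-- Compactness for finite families of conjugates of a small tuple under `Aut_e(𝔠)`. -/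
theorem exists_realize_of_finite (hM : IsMonster κ L M) (hE : Equivalence (Frel (M := M) pE))
    {J : Type} [Finite J] {ι π : Type u} (t : ι → M) (r : π → M) (hι : #ι < κ) (hπ : #π < κ)
    (k : γ → ι) (hk : t ∘ k = a) (k' : γ → π) (hk' : r ∘ k' = a)
    (p : Set (L.Formula ((J × ι) ⊕ π)))
    (hp : ∀ q : Finset (L.Formula ((J × ι) ⊕ π)), ↑q ⊆ p →
      ∃ g : J → Ge pE a, ∀ φ ∈ q, φ.Realize (Sum.elim (fun x : J × ι => g x.1 • t x.2) r)) :
    ∃ g : J → Ge pE a, ∀ φ ∈ p, φ.Realize (Sum.elim (fun x : J × ι => g x.1 • t x.2) r) := by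
  classical
  have hJι : #(J × ι) < κ := by
    rw [Cardinal.mk_prod, Cardinal.lift_uzero]
    refine Cardinal.mul_lt_of_lt hM.1.le (lt_trans ?_ hM.1) hι
    rw [Cardinal.lift_lt_aleph0]
    exact Cardinal.lt_aleph0_of_finite J
  obtain ⟨v, hv⟩ := hM.2.2 (J × ι) π r
    (p ∪ {φ | ∀ g : J → Ge pE a, φ.Realize (Sum.elim (fun x : J × ι => g x.1 • t x.2) r)})
    hJι hπ fun q hq => by
      obtain ⟨g, hg⟩ := hp (q.filter (· ∈ p)) fun φ hφ => (Finset.mem_filter.1 hφ).2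
      refine ⟨fun x : J × ι => g x.1 • t x.2, fun φ hφ => ?_⟩
      rcases hq hφ with h | h
      · exact hg φ (by simpa [h] using hφ)
      · exact h g
  have htp : ∀ j, SameTp (L := L) t (fun i => v (j, i)) := by
    intro j
    have key : ∀ ψ : L.Formula ι, ψ.Realize t → ψ.Realize fun i => v (j, i) := by
      intro ψ hψ
      have := hv (ψ.relabel fun i => Sum.inl (j, i)) <| Or.inr fun g => by
        rw [FirstOrder.Language.Formula.realize_relabel]
        exact (Ge_realize_iff (g j) ψ t).2 hψ
      rwa [FirstOrder.Language.Formula.realize_relabel] at this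
    refine fun ψ => ⟨key ψ, fun h => ?_⟩
    by_contra hn
    exact key ψ.not hn h
  choose f hf using fun j => hM.2.1 ι t _ hι (htp j)
  have hfE : ∀ j, f j ∈ AutE pE a := by
    intro j
    rw [mem_AutE_iff hE]
    intro φ hφ
    have := hv (φ.relabel (Sum.elim (fun c => Sum.inr (k' c)) fun c => Sum.inl (j, k c))) <|
      Or.inr fun g => by
        rw [FirstOrder.Language.Formula.realize_relabel]
        convert (mem_AutE_iff hE).1 (g j).2 φ hφ using 1
        ext (c | c)
        · exact congrFun hk' c
        · exact congrArg (g j • ·) (congrFun hk c)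
    rw [FirstOrder.Language.Formula.realize_relabel] at this
    convert this using 1
    ext (c | c)
    · exact (congrFun hk' c).symm
    · exact (congrArg (f j • ·) (congrFun hk c)).symm.trans (hf j (k c))
  refine ⟨fun j => ⟨f j, hfE j⟩, fun φ hφ => ?_⟩
  convert hv φ (Or.inl hφ) using 2
  ext ⟨j, i⟩
  exact hf j i

theorem compactSpace_family (hM : IsMonster κ L M) (hγ : #γ < κ)
    (hE : Equivalence (Frel (M := M) pE))
    (J : Type) [Finite J] {ι π : Type u} (t : ι → M) (r : π → M) (hι : #ι < κ) (hπ : #π < κ) :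
    @CompactSpace (J → Ge pE a) (tpTop L (fun g (x : J × ι) => g x.1 • t x.2) r) := by
  have h := compactSpace_tpTop (exists_realize_of_finite (J := J) (a := a) hM hE (Sum.elim t a)
    (Sum.elim r a) (hM.mk_sum_lt hι hγ) (hM.mk_sum_lt hπ hγ) Sum.inr rfl Sum.inr rfl)
  let _ := tpTop L (fun (g : J → Ge pE a) (x : J × ι) => g x.1 • t x.2) r
  refine ⟨?_⟩
  rw [← Set.image_id univ]
  refine @IsCompact.image _ _ (_) _ _ _ h.isCompact_univ
    (continuous_tpTop_of_comp (Sum.map (fun x => (x.1, Sum.inl x.2)) Sum.inl) fun g => ?_)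
  ext (x | x) <;> rfl

theorem compactSpace_aut (hM : IsMonster κ L M) (hγ : #γ < κ)
    (hE : Equivalence (Frel (M := M) pE))
    {ι π : Type u} (t : ι → M) (r : π → M) (hι : #ι < κ) (hπ : #π < κ) :
    @CompactSpace (Ge pE a) (tpTop L (fun g => g • t) r) := by
  have h := compactSpace_family (a := a) hM hγ hE Unit t r hι hπ
  let _ := tpTop L (fun g : Ge pE a => g • t) r
  refine ⟨?_⟩
  have hs : Function.Surjective fun g : Unit → Ge pE a => g () := fun g => ⟨fun _ => g, rfl⟩
  rw [← hs.range_eq, ← Set.image_univ]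
  refine @IsCompact.image _ _ (_) _ _ _ h.isCompact_univ
    (continuous_tpTop_of_comp (Sum.map (fun x => ((), x)) id) fun g => ?_)
  ext (x | x) <;> rfl

end AutTopology

section ClosedSets

open Set
open scoped Topology

variable {X Y : Type*} {δ π δ' π' : Type u} {ev : X → δ → M} {r : π → M} {ev' : Y → δ' → M}
  {r' : π' → M}

theorem isClosed_of_isCompact_tpTop {S : Set X} (hS : @IsCompact X (tpTop L ev r) S)
    (h : ∀ x ∈ S, ∀ y, (∀ φ : L.Formula (δ ⊕ π),
      φ.Realize (Sum.elim (ev x) r) ↔ φ.Realize (Sum.elim (ev y) r)) → y ∈ S) :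
    @IsClosed X (tpTop L ev r) S := by
  let _ := tpTop L ev r
  have : R1Space X := .induced _
  rw [← closure_subset_iff_isClosed, hS.closure_eq_biUnion_inseparable]
  exact iUnion₂_subset fun x hx y hy => h x hx y (realize_iff_of_inseparable hy)

theorem isClosed_image_tpTop (hX : @CompactSpace X (tpTop L ev r)) {f : X → Y}
    (hf : Continuous[tpTop L ev r, tpTop L ev' r'] f) {S : Set X}
    (hS : @IsClosed X (tpTop L ev r) S)
    (h : ∀ x ∈ f '' S, ∀ y, (∀ φ : L.Formula (δ' ⊕ π'),
      φ.Realize (Sum.elim (ev' x) r') ↔ φ.Realize (Sum.elim (ev' y) r')) → y ∈ f '' S) :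
    @IsClosed Y (tpTop L ev' r') (f '' S) := by
  let _ := tpTop L ev r
  let _ := tpTop L ev' r'
  exact isClosed_of_isCompact_tpTop (hS.isCompact.image hf) h

theorem normalSpace_tpTop (hX : @CompactSpace X (tpTop L ev r)) :
    @NormalSpace X (tpTop L ev r) := by
  let _ := tpTop L ev r
  have : R1Space X := .induced _
  infer_instance

end ClosedSets

section DeterminedCosets

open Set
open scoped Topology

variable {γ : Type u} {pE : Set (L.Formula (γ ⊕ γ))} {a : γ → M} {κ}

/-- The type over `t` of a conjugate `g • t` determines the coset `g K`. -/
def DeterminesCosets (K : Subgroup (Ge pE a)) {ι : Type u} (t : ι → M) : Prop :=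
  ∀ g g' : Ge pE a, tpOver (L := L) t (g • t) = tpOver t (g' • t) → g⁻¹ * g' ∈ K

theorem determinesCosets_of_fixers (hM : IsMonster κ L M) {ι : Type u} {t : ι → M} (hι : #ι < κ)
    (ht : eInDclTuple pE a t) {K : Subgroup (Ge pE a)} [hK : K.Normal]
    (h : ∀ s : Ge pE a, s • t = t → s ∈ K) : DeterminesCosets K t := by
  intro g g' hg
  have hιι : #(ι ⊕ ι) < κ := hM.mk_sum_lt hι hι
  obtain ⟨s, hs⟩ := hM.2.1 (ι ⊕ ι) (Sum.elim (g • t) t) (Sum.elim (g' • t) t) hιι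
    fun φ => Set.ext_iff.1 hg φ
  have hsE : s ∈ AutE pE a := ht s fun i => hs (Sum.inr i)
  have h1 : (⟨s, hsE⟩ : Ge pE a) ∈ K := h _ (funext fun i => hs (Sum.inr i))
  have h2 : (g⁻¹ * (⟨s, hsE⟩ : Ge pE a)⁻¹ * g') ∈ K := by
    refine h _ ?_
    rw [mul_smul, mul_smul, inv_smul_eq_iff, inv_smul_eq_iff]
    exact (funext fun i => hs (Sum.inl i)).symm
  have h3 := mul_mem (hK.conj_mem _ h1 g⁻¹) h2
  convert h3 using 1
  group

variable {K : Subgroup (Ge pE a)} {ι : Type u} {t : ι → M}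

theorem DeterminesCosets.mem {D : Set (Ge pE a)} (ht : DeterminesCosets K t)
    (hD : ∀ g ∈ D, ∀ k ∈ K, g * k ∈ D) {g g' : Ge pE a} (hg : g ∈ D)
    (h : ∀ φ : L.Formula (ι ⊕ ι),
      φ.Realize (Sum.elim (g • t) t) ↔ φ.Realize (Sum.elim (g' • t) t)) : g' ∈ D := by
  simpa using hD g hg _ (ht g g' (Set.ext h))

/-- A product of closed sets is closed as soon as it is a union of cosets of `K`. -/
theorem DeterminesCosets.isClosed_mul (ht : DeterminesCosets K t) (hM : IsMonster κ L M)
    (hγ : #γ < κ) (hE : Equivalence (Frel (M := M) pE)) (hι : #ι < κ)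
    {ι₁ π₁ ι₂ π₂ : Type u} {t₁ : ι₁ → M} {r₁ : π₁ → M} {t₂ : ι₂ → M} {r₂ : π₂ → M}
    (hι₁ : #ι₁ < κ) (hπ₁ : #π₁ < κ) (hι₂ : #ι₂ < κ) (hπ₂ : #π₂ < κ) {D₁ D₂ : Set (Ge pE a)}
    (hD₁ : @IsClosed _ (tpTop L (fun g : Ge pE a => g • t₁) r₁) D₁)
    (hD₂ : @IsClosed _ (tpTop L (fun g : Ge pE a => g • t₂) r₂) D₂)
    (hD : ∀ g ∈ D₁ * D₂, ∀ k ∈ K, g * k ∈ D₁ * D₂) :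
    @IsClosed _ (tpTop L (fun g : Ge pE a => g • t) t) (D₁ * D₂) := by
  have hX := compactSpace_family (a := a) hM hγ hE Bool (Sum.elim (Sum.elim t₁ t₂) (Sum.elim t r₂))
    (Sum.elim r₁ t) (hM.mk_sum_lt (hM.mk_sum_lt hι₁ hι₂) (hM.mk_sum_lt hι hπ₂))
    (hM.mk_sum_lt hπ₁ hι)
  set τ := tpTop L (fun (g : Bool → Ge pE a) (x : Bool × ((ι₁ ⊕ ι₂) ⊕ (ι ⊕ π₂))) =>
    g x.1 • (Sum.elim (Sum.elim t₁ t₂) (Sum.elim t r₂)) x.2) (Sum.elim r₁ t)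
  have hS : IsClosed[τ] {x | x false ∈ D₁ ∧ (x false)⁻¹ * x true ∈ D₂} := by
    refine @IsClosed.inter _ _ _ τ (@IsClosed.preimage _ _ τ (_) (fun x => x false) ?_ _ hD₁)
      (@IsClosed.preimage _ _ τ (_) (fun x => (x false)⁻¹ * x true) ?_ _ hD₂)
    · refine continuous_tpTop_of_comp (Sum.map (fun i => (false, Sum.inl (Sum.inl i))) Sum.inl)
        fun x => ?_
      ext (i | i) <;> rfl
    · refine continuous_tpTop fun φ => ⟨φ.relabel (Sum.elim
        (fun i => Sum.inl (true, Sum.inl (Sum.inr i)))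
        (fun i => Sum.inl (false, Sum.inr (Sum.inr i)))), fun x => ?_⟩
      rw [FirstOrder.Language.Formula.realize_relabel, ← Ge_realize_iff (x false), smul_sumElim,
        mul_smul, smul_inv_smul]
      refine iff_of_eq (congrArg _ ?_)
      ext (i | i) <;> rfl
  have himg : (fun x : Bool → Ge pE a => x true) ''
      {x | x false ∈ D₁ ∧ (x false)⁻¹ * x true ∈ D₂} = D₁ * D₂ := by
    ext g
    constructor
    · rintro ⟨x, ⟨h₁, h₂⟩, rfl⟩
      exact ⟨_, h₁, _, h₂, mul_inv_cancel_left _ _⟩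
    · rintro ⟨h₁, hh₁, h₂, hh₂, rfl⟩
      exact ⟨fun j => if j then h₁ * h₂ else h₁, by simpa using ⟨hh₁, hh₂⟩, rfl⟩
  rw [← himg] at hD ⊢
  refine isClosed_image_tpTop hX (continuous_tpTop_of_comp
    (Sum.map (fun i => (true, Sum.inr (Sum.inl i))) Sum.inr) fun x => ?_) hS
    fun x hx y hy => ht.mem hD hx hy
  ext (i | i) <;> rfl

/-- A closed set which is a union of cosets of `K` is closed in the topology given by any tuple
determining the cosets of `K`. -/
theorem DeterminesCosets.isClosed (ht : DeterminesCosets K t) (hM : IsMonster κ L M)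
    (hγ : #γ < κ) (hE : Equivalence (Frel (M := M) pE)) (hι : #ι < κ)
    {ι' π' : Type u} {t' : ι' → M} {r' : π' → M} (hι' : #ι' < κ) (hπ' : #π' < κ)
    {D : Set (Ge pE a)} (hD' : @IsClosed _ (tpTop L (fun g : Ge pE a => g • t') r') D)
    (hD : ∀ g ∈ D, ∀ k ∈ K, g * k ∈ D) :
    @IsClosed _ (tpTop L (fun g : Ge pE a => g • t) t) D := by
  have hX := compactSpace_aut (a := a) hM hγ hE (Sum.elim t' t) (Sum.elim r' t) (hM.mk_sum_lt hι' hι)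
    (hM.mk_sum_lt hπ' hι)
  rw [← Set.image_id D] at hD ⊢
  refine isClosed_image_tpTop hX (continuous_tpTop_of_comp (Sum.map Sum.inr Sum.inr) fun x => ?_)
    (S := D) (@IsClosed.preimage _ _ (_) (_) id ?_ _ hD') fun x hx y hy => ht.mem hD hx hy
  · ext (i | i) <;> rfl
  · refine continuous_tpTop_of_comp (Sum.map Sum.inl Sum.inl) fun x => ?_
    ext (i | i) <;> rfl

variable (t) in
/-- A topology coinduced from the space of types over `t` of conjugates of `t` is a quotient of the
logic topology on the automorphism group. -/
theorem isClosed_coinduced_types {Q : Type*} {f : Ge pE a → Q}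
    {ν : ↥(range fun g : Ge pE a => tpOver (L := L) t (g • t)) → Q}
    (hν : ∀ g, ν ⟨_, mem_range_self g⟩ = f g) {C : Set Q} :
    IsClosed[(typeSetTop (range fun g : Ge pE a => tpOver (L := L) t (g • t))).coinduced ν] C ↔
      @IsClosed _ (tpTop L (fun g : Ge pE a => g • t) t) (f ⁻¹' C) := by
  have hf : f = ν ∘ rangeFactorization fun g : Ge pE a => tpOver (L := L) t (g • t) :=
    funext fun g => (hν g).symm
  have hτ : tpTop L (fun g : Ge pE a => g • t) t = (typeSetTop _).induced
      (rangeFactorization fun g : Ge pE a => tpOver (L := L) t (g • t)) := by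
    rw [typeSetTop, induced_compose]
    rfl
  rw [@isClosed_coinduced _ _ (typeSetTop _), hτ, @isClosed_induced_iff _ _ (typeSetTop _), hf,
    preimage_comp]
  constructor
  · exact fun h => ⟨_, h, rfl⟩
  · rintro ⟨D, hD, h⟩
    rwa [← rangeFactorization_surjective.preimage_injective h]

end DeterminedCosets

section CosetTopology

open Set
open scoped Topology

variable {γ : Type u} {pE : Set (L.Formula (γ ⊕ γ))} {a : γ → M} {κ}

theorem isClosed_smul_eq {δ : Type u} (u v : δ → M) :
    @IsClosed _ (tpTop L (fun g : Ge pE a => g • u) v) {g : Ge pE a | g • u = v} := by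
  have h : {g : Ge pE a | g • u = v} = ⋂ i : δ, {g : Ge pE a | FirstOrder.Language.Formula.Realize
      (((FirstOrder.Language.var (Sum.inl i) : L.Term (δ ⊕ δ))).equal
        (FirstOrder.Language.var (Sum.inr i))) (Sum.elim (g • u) v)} := by
    ext g
    simp [FirstOrder.Language.Formula.realize_equal, funext_iff]
  rw [h]
  exact @isClosed_iInter _ _ (_) _ fun i =>
    @IsClopen.isClosed _ (tpTop L (fun g : Ge pE a => g • u) v) _ (isClopen_tpTop _)

variable {K : Subgroup (Ge pE a)} {ι : Type u} {t : ι → M} [𝒢 : TopologicalSpace (Ge pE a)]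

variable (K t 𝒢) in
/-- The topology on the automorphism group induced from its quotient by `K`, where the quotient has
the topology given by the types over `t` of the conjugates of `t`. -/
def IsCosetTopology : Prop :=
  ∀ D : Set (Ge pE a), IsClosed D ↔
    @IsClosed _ (tpTop L (fun g : Ge pE a => g • t) t) D ∧ ∀ g ∈ D, ∀ k ∈ K, g * k ∈ D

theorem IsCosetTopology.tpTop_le (h𝒢 : IsCosetTopology K t 𝒢) :
    tpTop L (fun g : Ge pE a => g • t) t ≤ 𝒢 := by
  intro U hU
  have := ((h𝒢 Uᶜ).1 hU.isClosed_compl).1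
  simpa using @IsClosed.isOpen_compl _ (_) _ this

theorem IsCosetTopology.mul_mem_of_isOpen (h𝒢 : IsCosetTopology K t 𝒢) {U : Set (Ge pE a)}
    (hU : IsOpen U) {g k : Ge pE a} (hg : g ∈ U) (hk : k ∈ K) : g * k ∈ U := by
  by_contra h
  have := ((h𝒢 Uᶜ).1 hU.isClosed_compl).2 _ h _ (inv_mem hk)
  exact this (by simpa using hg)

theorem IsCosetTopology.separatelyContinuousMul (h𝒢 : IsCosetTopology K t 𝒢) [hK : K.Normal]
    (ht : DeterminesCosets K t) (hM : IsMonster κ L M) (hγ : #γ < κ)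
    (hE : Equivalence (Frel (M := M) pE)) (hι : #ι < κ) : SeparatelyContinuousMul (Ge pE a) where
  continuous_const_mul {h} := by
    refine continuous_iff_isClosed.2 fun D hD => (h𝒢 _).2 ?_
    rw [h𝒢] at hD
    have hinv : ∀ g ∈ (h * ·) ⁻¹' D, ∀ k ∈ K, g * k ∈ (h * ·) ⁻¹' D := fun g hg k hk => by
      simpa [mul_assoc] using hD.2 _ hg k hk
    refine ⟨ht.isClosed hM hγ hE hι (t' := t) (r' := h⁻¹ • t) hι hι
      (@IsClosed.preimage _ _ (_) (_) _ (continuous_tpTop fun φ => ⟨φ, fun g => ?_⟩) _ hD.1) hinv,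
      hinv⟩
    rw [← Ge_realize_iff h φ (Sum.elim (g • t) _), smul_sumElim, mul_smul, smul_inv_smul]
  continuous_mul_const {h} := by
    refine continuous_iff_isClosed.2 fun D hD => (h𝒢 _).2 ?_
    rw [h𝒢] at hD
    have hinv : ∀ g ∈ (· * h) ⁻¹' D, ∀ k ∈ K, g * k ∈ (· * h) ⁻¹' D := fun g hg k hk => by
      simpa [mul_assoc] using hD.2 _ hg _ (hK.conj_mem' k hk h)
    refine ⟨ht.isClosed hM hγ hE hι (t' := h • t) (r' := t) hι hι
      (@IsClosed.preimage _ _ (_) (_) _ (continuous_tpTop fun φ => ⟨φ, fun g => ?_⟩) _ hD.1) hinv,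
      hinv⟩
    rw [mul_smul]

theorem IsCosetTopology.continuousInv (h𝒢 : IsCosetTopology K t 𝒢) [hK : K.Normal]
    (ht : DeterminesCosets K t) (hM : IsMonster κ L M) (hγ : #γ < κ)
    (hE : Equivalence (Frel (M := M) pE)) (hι : #ι < κ) : ContinuousInv (Ge pE a) where
  continuous_inv := by
    refine continuous_iff_isClosed.2 fun D hD => (h𝒢 _).2 ?_
    rw [h𝒢] at hD
    have hinv : ∀ g ∈ Inv.inv ⁻¹' D, ∀ k ∈ K, g * k ∈ Inv.inv ⁻¹' D := fun g hg k hk => by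
      simpa [mul_assoc] using hD.2 _ hg _ (hK.conj_mem _ (inv_mem hk) g)
    refine ⟨ht.isClosed hM hγ hE hι (t' := t) (r' := t) hι hι
      (@IsClosed.preimage _ _ (_) (_) _
        (continuous_tpTop fun φ => ⟨φ.relabel Sum.swap, fun g => ?_⟩) _ hD.1) hinv, hinv⟩
    rw [← Ge_realize_iff g φ, smul_sumElim, smul_inv_smul,
      FirstOrder.Language.Formula.realize_relabel]
    refine iff_of_eq (congrArg _ ?_)
    ext (i | i) <;> rfl

theorem IsCosetTopology.exists_mem_connectedComponent (h𝒢 : IsCosetTopology K t 𝒢) [K.Normal]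
    (ht : DeterminesCosets K t) (hM : IsMonster κ L M) (hγ : #γ < κ)
    (hE : Equivalence (Frel (M := M) pE)) (hι : #ι < κ) {δ : Type u} (hδ : #δ < κ) {u v : δ → M}
    (h : ∀ U : Subgroup (Ge pE a), IsOpen (U : Set (Ge pE a)) → ∃ f ∈ U, f • u = v) :
    ∃ f ∈ connectedComponent (1 : Ge pE a), f • u = v := by
  have := h𝒢.separatelyContinuousMul ht hM hγ hE hι
  have := h𝒢.continuousInv ht hM hγ hE hι
  have hcpt : @CompactSpace _ (tpTop L (fun g : Ge pE a => g • t) t) :=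
    compactSpace_aut hM hγ hE t t hι hι
  have : CompactSpace (Ge pE a) := by
    refine ⟨?_⟩
    rw [← Set.image_id univ]
    exact @IsCompact.image _ _ (_) _ _ _ hcpt.isCompact_univ (continuous_id_of_le h𝒢.tpTop_le)
  have hinv : ∀ {C D : Set (Ge pE a)}, IsClosed D → ∀ g ∈ C * D, ∀ k ∈ K, g * k ∈ C * D := by
    rintro C D hD _ ⟨c, hc, d, hd, rfl⟩ k hk
    exact ⟨c, hc, d * k, ((h𝒢 D).1 hD).2 d hd k hk, (mul_assoc _ _ _).symm⟩
  have hmul : ∀ {δ' π' : Type u} {t' : δ' → M} {r' : π' → M} {C D : Set (Ge pE a)},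
      #δ' < κ → #π' < κ → @IsClosed _ (tpTop L (fun g : Ge pE a => g • t') r') C → IsClosed D →
      IsClosed (C * D) := fun hδ' hπ' hC hD =>
    (h𝒢 _).2 ⟨ht.isClosed_mul hM hγ hE hι hδ' hπ' hι hι hC ((h𝒢 _).1 hD).1 (hinv hD), hinv hD⟩
  have : NormalSpace (Ge pE a) := normalSpace_of_le _ (normalSpace_tpTop hcpt) h𝒢.tpTop_le
    fun C hC => hmul hι hι hC isClosed_closure
  obtain ⟨f, hf, hf1⟩ := exists_mem_connectedComponent_one
    (fun C D hC hD => hmul hι hι ((h𝒢 _).1 hC).1 hD)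
    (hmul hδ hδ (isClosed_smul_eq u v) isClosed_closure)
    fun U hU => (h U hU).imp fun f hf => ⟨hf.2, hf.1⟩
  exact ⟨f, hf1, hf⟩

end CosetTopology

section GaloisTopology

open Set
open scoped Topology

variable {γ : Type u} {pE : Set (L.Formula (γ ⊕ γ))} {a : γ → M} {κ}
variable {V β : Type u} {pS : Set (L.Formula (V ⊕ β))} {bp : β → M}

theorem determinesCosets_model (hM : IsMonster κ L M) {N : L.ElementarySubstructure M}
    (hN : #N < κ) (hNdcl : ∀ g : M ≃[L] M, (∀ x ∈ N, g x = x) → g ∈ AutE pE a) :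
    DeterminesCosets (AutfL κ pE a) (Subtype.val : ↥N → M) :=
  determinesCosets_of_fixers hM hN (fun f hf => hNdcl f fun x hx => hf ⟨x, hx⟩) fun _ hs =>
    Subgroup.subset_normalClosure ⟨N, hN, hNdcl, fun x hx => congrFun hs ⟨x, hx⟩⟩

theorem IsLascarTuple.determinesCosets {hInv : SolInv pE a pS bp} {ιb : Type u}
    {b : ιb → SolT pS bp} (hb : IsLascarTuple κ pE a hInv b) (hM : IsMonster κ L M) (hV : #V < κ)
    (hbdcl : eInDclTuple pE a (flat b)) :
    DeterminesCosets ((AutfLS κ pE a hInv).comap (toGS pE a hInv)) (flat b) := by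
  have := AutfLS_normal κ pE a hInv
  refine determinesCosets_of_fixers hM (hM.mk_prod_lt hb.1 hV) hbdcl fun s hs =>
    (hb.2 _).2 ?_
  rw [flat_toGS_smul, hs]
  exact LEq.refl κ pE a _

theorem projT_eq_iff {g g' : Ge pE a} :
    projT κ pE a g = projT κ pE a g' ↔ g⁻¹ * g' ∈ AutfL κ pE a :=
  QuotientGroup.eq

theorem projS_eq_iff {hInv : SolInv pE a pS bp} {g g' : Ge pE a} :
    projS κ pE a hInv g = projS κ pE a hInv g' ↔
      g⁻¹ * g' ∈ (AutfLS κ pE a hInv).comap (toGS pE a hInv) := by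
  rw [Subgroup.mem_comap, map_mul, map_inv]
  exact QuotientGroup.eq

theorem isClosed_galTopT_iff {N : L.ElementarySubstructure M}
    (ht : DeterminesCosets (AutfL κ pE a) (Subtype.val : ↥N → M)) {C : Set (GalT κ pE a)} :
    IsClosed[galTopT κ pE a N] C ↔ @IsClosed _
      (tpTop L (fun g : Ge pE a => g • (Subtype.val : ↥N → M)) (Subtype.val : ↥N → M))
      (projT κ pE a ⁻¹' C) :=
  isClosed_coinduced_types _ (ν := nuT κ pE a N) fun g =>
    by
    have h : tpOver (Subtype.val : ↥N → M) (g • Subtype.val) ∈ SMod pE a N := mem_range_self g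
    exact projT_eq_iff.2 (ht _ _ (Set.mem_range.mp h).choose_spec)

theorem isClosed_galTopb_iff {hInv : SolInv pE a pS bp} {ιb : Type u} {b : ιb → SolT pS bp}
    (ht : DeterminesCosets ((AutfLS κ pE a hInv).comap (toGS pE a hInv)) (flat b))
    {C : Set (GalL κ pE a hInv)} :
    IsClosed[galTopb κ pE a hInv b] C ↔ @IsClosed _
      (tpTop L (fun g : Ge pE a => g • flat b) (flat b)) (projS κ pE a hInv ⁻¹' C) :=
  isClosed_coinduced_types _ (ν := nub κ pE a hInv b) fun g =>
    by
    have h : tpOver (flat b) (g • flat b) ∈ Sb pE a b := mem_range_self g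
    exact projS_eq_iff.2 (ht _ _ (Set.mem_range.mp h).choose_spec)

theorem isCosetTopology_induced {N : L.ElementarySubstructure M}
    (ht : DeterminesCosets (AutfL κ pE a) (Subtype.val : ↥N → M)) :
    IsCosetTopology (AutfL κ pE a) (Subtype.val : ↥N → M)
      ((galTopT κ pE a N).induced (projT κ pE a)) := by
  intro D
  rw [@isClosed_induced_iff _ _ (galTopT κ pE a N)]
  constructor
  · rintro ⟨C, hC, rfl⟩
    refine ⟨(isClosed_galTopT_iff ht).1 hC, fun g hg k hk => ?_⟩
    rwa [mem_preimage, ← projT_eq_iff.2 (show g⁻¹ * (g * k) ∈ _ by simpa using hk)]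
  · rintro ⟨hD, hinv⟩
    have h : projT κ pE a ⁻¹' (projT κ pE a '' D) = D := by
      refine Subset.antisymm ?_ (subset_preimage_image _ _)
      rintro g ⟨g', hg', h⟩
      simpa using hinv g' hg' _ (projT_eq_iff.1 h)
    exact ⟨_, (isClosed_galTopT_iff ht).2 (h.symm ▸ hD), h⟩

theorem continuous_xiL (hM : IsMonster κ L M) (hγ : #γ < κ)
    (hE : Equivalence (Frel (M := M) pE)) (hV : #V < κ) {hInv : SolInv pE a pS bp}
    {ιb : Type u} {b : ιb → SolT pS bp} (hb : #ιb < κ)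
    (hbt : DeterminesCosets ((AutfLS κ pE a hInv).comap (toGS pE a hInv)) (flat b))
    {N : L.ElementarySubstructure M} (hN : #N < κ)
    (ht : DeterminesCosets (AutfL κ pE a) (Subtype.val : ↥N → M)) :
    Continuous[galTopT κ pE a N, galTopb κ pE a hInv b] (xiL κ pE a hInv) := by
  refine (@continuous_iff_isClosed _ _ (_) (_) _).2 fun C hC => ?_
  rw [isClosed_galTopb_iff hbt] at hC
  rw [isClosed_galTopT_iff ht]
  refine ht.isClosed hM hγ hE hN (hM.mk_prod_lt hb hV) (hM.mk_prod_lt hb hV) hC fun g hg k hk => ?_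
  have hk' := projT_eq_iff.2 (show g⁻¹ * (g * k) ∈ AutfL κ pE a by simpa using hk)
  rwa [mem_preimage, mem_preimage, ← hk']

/-- A union of cosets which is clopen in the Galois group of the theory contains the preimage of
the connected component of the relativized Galois group. -/
theorem mem_of_projS_mem_connectedComponent (hM : IsMonster κ L M) (hγ : #γ < κ)
    (hE : Equivalence (Frel (M := M) pE)) (hV : #V < κ) {hInv : SolInv pE a pS bp}
    {ιb : Type u} {b : ιb → SolT pS bp} (hb : #ιb < κ)
    (hbt : DeterminesCosets ((AutfLS κ pE a hInv).comap (toGS pE a hInv)) (flat b))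
    {ι' π' : Type u} {t' : ι' → M} {r' : π' → M} (hι' : #ι' < κ) (hπ' : #π' < κ)
    {W : Set (Ge pE a)} (hW : @IsClopen _ (tpTop L (fun g : Ge pE a => g • t') r') W)
    (h1 : 1 ∈ W)
    (hinv : ∀ g ∈ W, ∀ k ∈ (AutfLS κ pE a hInv).comap (toGS pE a hInv), g * k ∈ W) {g : Ge pE a}
    (hg : projS κ pE a hInv g ∈
      @connectedComponent _ (galTopb κ pE a hInv b) (projS κ pE a hInv 1)) : g ∈ W := by
  have key : ∀ {D : Set (Ge pE a)}, (∀ g ∈ D, ∀ k ∈ (AutfLS κ pE a hInv).comap (toGS pE a hInv),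
      g * k ∈ D) → projS κ pE a hInv ⁻¹' (projS κ pE a hInv '' D) = D := by
    intro D hD
    refine Subset.antisymm ?_ (subset_preimage_image _ _)
    rintro g ⟨g', hg', h⟩
    simpa using hD g' hg' _ (projS_eq_iff.1 h)
  have hcl : ∀ {D : Set (Ge pE a)}, (∀ g ∈ D, ∀ k ∈ (AutfLS κ pE a hInv).comap (toGS pE a hInv),
      g * k ∈ D) → @IsClosed _ (tpTop L (fun g : Ge pE a => g • t') r') D →
      @IsClosed _ (tpTop L (fun g : Ge pE a => g • flat b) (flat b)) D := fun hD hD' =>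
    hbt.isClosed hM hγ hE (hM.mk_prod_lt hb hV) hι' hπ' hD' hD
  have hcompl : ∀ g ∈ Wᶜ, ∀ k ∈ (AutfLS κ pE a hInv).comap (toGS pE a hInv), g * k ∈ Wᶜ :=
    fun g hg k hk hgk => hg (by simpa using hinv _ hgk _ (inv_mem hk))
  have hC : @IsClopen _ (galTopb κ pE a hInv b) (projS κ pE a hInv '' W) := by
    refine ⟨?_, ?_⟩
    · rw [isClosed_galTopb_iff hbt, key hinv]
      exact hcl hinv hW.1
    · rw [← @isClosed_compl_iff _ (galTopb κ pE a hInv b), isClosed_galTopb_iff hbt,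
        preimage_compl, key hinv]
      exact hcl hcompl (@IsOpen.isClosed_compl _ (_) _ hW.2)
  have := (@IsClopen.connectedComponent_subset _ (galTopb κ pE a hInv b) _ _ hC
    (mem_image_of_mem _ h1)) hg
  rw [← key hinv]
  exact this

end GaloisTopology

section Statements

variable {γ : Type u} (pE : Set (L.Formula (γ ⊕ γ))) (a : γ → M)
variable {V β : Type u} {pS : Set (L.Formula (V ⊕ β))} {bp : β → M}


/-- Proposition 2.17(2): for `H = π_b⁻¹[Gal_L^0(Σ, e)]` and
tuples `c`, `d` of realizations of `Σ`, `c ≡ᴴ d` iff `c ≡ˢ_e d`. -/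
theorem orbEq_component_iff_Seq (hM : IsMonster κ L M) (hγ : #γ < κ)
    (hE : Equivalence (Frel (M := M) pE)) (hV : #V < κ) (hβ : #β < κ)
    (hInv : SolInv pE a pS bp)
    (hedcl : eInDclSigma κ pE a pS bp)
    {ιb : Type u} (b : ιb → SolT pS bp)
    (hb : IsLascarTuple κ pE a hInv b) (hbdcl : eInDclTuple pE a (flat b))
    (N : L.ElementarySubstructure M) (hN : #N < κ)
    (hNdcl : ∀ g : M ≃[L] M, (∀ x ∈ N, g x = x) → g ∈ AutE pE a)
    {ι : Type u} (hι : #ι < κ) (c d : ι → SolT pS bp) :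
    orbEq (hInv := hInv) pE a
        (projb κ pE a hInv ⁻¹'
          (@connectedComponent _ (galTopb κ pE a hInv b) (projb κ pE a hInv 1))) c d ↔
      Seq κ pE a N (flat c) (flat d) := by
  have ht := determinesCosets_model hM hN hNdcl
  have hbt := hb.determinesCosets hM hV hbdcl
  have h1 : projb κ pE a hInv 1 = projS κ pE a hInv 1 := by rw [projS, map_one]
  constructor
  · rintro ⟨h, hh, rfl⟩
    obtain ⟨g, rfl⟩ : ∃ g, toGS pE a hInv g = h :=
      (resPerm pE a hInv).rangeRestrict_surjective h
    rw [Set.mem_preimage, h1] at hh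
    let 𝒢 : TopologicalSpace (Ge pE a) := (galTopT κ pE a N).induced (projT κ pE a)
    have h𝒢 : IsCosetTopology (AutfL κ pE a) (Subtype.val : ↥N → M) 𝒢 :=
      isCosetTopology_induced ht
    have := h𝒢.separatelyContinuousMul ht hM hγ hE hN
    obtain ⟨f, hf, hfc⟩ := h𝒢.exists_mem_connectedComponent ht hM hγ hE hN
      (hM.mk_prod_lt hι hV) (u := flat c) (v := g • flat c) fun U hU => by
        have hW := isClopen_subgroup_mul hU
          ((AutfLS κ pE a hInv).comap (toGS pE a hInv) : Set (Ge pE a))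
        obtain ⟨u, hu, k, hk, rfl⟩ := mem_of_projS_mem_connectedComponent hM hγ hE hV hb.1 hbt
          hN hN ⟨hW.1.mono h𝒢.tpTop_le, hW.2.mono h𝒢.tpTop_le⟩
          ⟨1, one_mem _, 1, one_mem _, one_mul 1⟩ (by
            rintro _ ⟨u, hu, k, hk, rfl⟩ k' hk'
            exact ⟨u, hu, k * k', mul_mem hk hk', (mul_assoc _ _ _).symm⟩) hh
        obtain ⟨l, hl, hlc⟩ := hk ι hι c
        refine ⟨u * l, h𝒢.mul_mem_of_isOpen hU hu hl, ?_⟩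
        rw [mul_smul, hlc, flat_toGS_smul]
        exact (mul_smul u k (flat c)).symm
    refine ⟨f, ?_, hfc⟩
    exact (@Continuous.image_connectedComponent_subset _ _ 𝒢 (galTopT κ pE a N) _
      continuous_induced_dom 1) (Set.mem_image_of_mem _ hf)
  · rintro ⟨f, hf, hfc⟩
    refine ⟨toGS pE a hInv f, ?_, ?_⟩
    · rw [Set.mem_preimage, h1]
      exact (@Continuous.image_connectedComponent_subset _ _ (galTopT κ pE a N)
        (galTopb κ pE a hInv b) _ (continuous_xiL hM hγ hE hV hb.1 hbt hN ht) _)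
        (Set.mem_image_of_mem _ hf)
    · funext i
      refine Subtype.ext (funext fun j => ?_)
      exact congrFun hfc (i, j)

end Statements

end RelLascar
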